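/- Let I ⊆ ℝ be an open interval, β : I → ℂ a C¹ path, z ∈ ℂ with z ≠ β(t) for all t ∈ I, λ₁ ≠ λ₂ fixed complex numbers, and ζ₁, ζ₂, h₁, h₂ : I → ℂ continuous functions with h₁(t) ≠ h₂(t) for all t. Let q₁, q₂ : I → ℂ be differentiable with q₁(t) ≠ q₂(t) for all t, and define Q(t) = [[1, 1],[q₁(t), q₂(t)]], H(t) = [[1, 1],[h₁(t), h₂(t)]], V(t) = Q(t) · diag(λ₁, λ₂) · Q(t)⁻¹, and r(t) = H(t) · diag(ζ₁(t), ζ₂(t)) · H(t)⁻¹. Then V satisfies the matrix differential equation V'(t) = (β'(t)/(z − β(t))) · ( r(t)·V(t) − V(t)·r(t) ) on I if and only if, for each k ∈ {1, 2}, q_k satisfies the Riccati equation q_k'(t) = −β'(t) · (ζ₁(t) − ζ₂(t)) · (q_k(t) − h₁(t)) · (q_k(t) − h₂(t)) / ( (z − β(t)) · (h₁(t) − h₂(t)) ). -/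

import Mathlib

open Set Filter MeasureTheory Topology

noncomputable section

/-- `M₂(ℂ)`: 2×2 complex matrices. -/
abbrev M2 := Matrix (Fin 2) (Fin 2) ℂ

attribute [local instance] Matrix.normedAddCommGroup Matrix.normedSpace

/-- The conjugate of `diagonal ![a, b]` by the matrix with columns `(1, x)`, `(1, y)`. -/
theorem conj_diagonal_eq (a b : ℂ) {x y : ℂ} (hxy : x ≠ y) :
    (!![1, 1; x, y] : M2) * Matrix.diagonal ![a, b] * (!![1, 1; x, y] : M2)⁻¹ =
      !![(a * y - b * x) / (y - x), (b - a) / (y - x);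
        (a - b) * (x * y) / (y - x), (b * y - a * x) / (y - x)] := by
  have hd : y - x ≠ 0 := sub_ne_zero.2 hxy.symm
  have hdet : IsUnit (!![1, 1; x, y] : M2).det := by
    simpa [Matrix.det_fin_two_of] using hd
  let := Matrix.invertibleOfIsUnitDet _ hdet
  rw [Matrix.mul_inv_eq_iff_eq_mul_of_invertible]
  ext i j
  fin_cases i <;> fin_cases j <;>
    simp [Matrix.mul_apply, Fin.sum_univ_two, Matrix.diagonal] <;> field_simp <;> ring

/-- The derivative of the conjugate of `diagonal ![a, b]` by the matrix with columns `(1, x)`,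
`(1, y)`, when `x` and `y` move with velocities `u` and `v`. -/
def conjVelocity (a b x y u v : ℂ) : M2 :=
  ((a - b) / (y - x) ^ 2) • !![y * u - x * v, v - u; y ^ 2 * u - x ^ 2 * v, x * v - y * u]

theorem conjVelocity_inj {a b x y : ℂ} (hab : a ≠ b) (hxy : x ≠ y) {u v u' v' : ℂ} :
    conjVelocity a b x y u v = conjVelocity a b x y u' v' ↔ u = u' ∧ v = v' := by
  refine ⟨fun h => ?_, fun ⟨hu, hv⟩ => by rw [hu, hv]⟩
  have hd : y - x ≠ 0 := sub_ne_zero.2 hxy.symm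
  have hc : (a - b) / (y - x) ^ 2 ≠ 0 := div_ne_zero (sub_ne_zero.2 hab) (pow_ne_zero 2 hd)
  have h' := smul_right_injective M2 hc h
  have h00 : y * u - x * v = y * u' - x * v' := by simpa using congrFun (congrFun h' 0) 0
  have h01 : v - u = v' - u' := by simpa using congrFun (congrFun h' 0) 1
  constructor <;> apply mul_left_cancel₀ hd
  · linear_combination h00 + x * h01
  · linear_combination h00 + y * h01

theorem hasDerivAt_conj_diagonal (a b : ℂ) {x y : ℝ → ℂ} {u v : ℂ} {t : ℝ} (hxy : x t ≠ y t)
    (hx : HasDerivAt x u t) (hy : HasDerivAt y v t) :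
    HasDerivAt (fun s => (!![1, 1; x s, y s] : M2) * Matrix.diagonal ![a, b] *
      (!![1, 1; x s, y s] : M2)⁻¹) (conjVelocity a b (x t) (y t) u v) t := by
  have hd : y t - x t ≠ 0 := sub_ne_zero.2 hxy.symm
  have hne : ∀ᶠ s in 𝓝 t, x s ≠ y s :=
    (hx.continuousAt.prodMk hy.continuousAt).eventually (isOpen_ne_fun continuous_fst
      continuous_snd |>.mem_nhds hxy)
  refine HasDerivAt.congr_of_eventuallyEq ?_ (hne.mono fun s hs => conj_diagonal_eq a b hs)
  have hyx := hy.sub hx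
  refine hasDerivAt_pi.2 fun i => hasDerivAt_pi.2 fun j => ?_
  fin_cases i <;> fin_cases j
  · refine (((hy.const_mul a).sub (hx.const_mul b)).div hyx hd).congr_deriv ?_
    simp [conjVelocity]
    field_simp
    ring
  · refine ((hasDerivAt_const t (b - a)).div hyx hd).congr_deriv ?_
    simp [conjVelocity]
    field_simp
    ring
  · refine (((hx.mul hy).const_mul (a - b)).div hyx hd).congr_deriv ?_
    simp [conjVelocity]
    field_simp
    ring
  · refine (((hy.const_mul b).sub (hx.const_mul a)).div hyx hd).congr_deriv ?_
    simp [conjVelocity]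
    field_simp
    ring

/-- A commutator with a conjugated diagonal matrix moves the eigenvector slopes `x`, `y` along the
quadratic vector field whose zeros are the slopes `p`, `q`. -/
theorem smul_commutator_eq_conjVelocity (a b c d k w : ℂ) {x y p q : ℂ} (hw : w ≠ 0)
    (hxy : x ≠ y) (hpq : p ≠ q) {V r : M2}
    (hV : V = !![1, 1; x, y] * Matrix.diagonal ![a, b] * (!![1, 1; x, y])⁻¹)
    (hr : r = !![1, 1; p, q] * Matrix.diagonal ![c, d] * (!![1, 1; p, q])⁻¹) :
    (k / w) • (r * V - V * r) =
      conjVelocity a b x y (-k * (c - d) * (x - p) * (x - q) / (w * (p - q)))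
        (-k * (c - d) * (y - p) * (y - q) / (w * (p - q))) := by
  have hd : y - x ≠ 0 := sub_ne_zero.2 hxy.symm
  have he : p - q ≠ 0 := sub_ne_zero.2 hpq
  rw [hV, hr, conj_diagonal_eq a b hxy, conj_diagonal_eq c d hpq, ← neg_sub p q]
  ext i j
  fin_cases i <;> fin_cases j <;>
    simp [conjVelocity] <;> field_simp <;> ring

/-- **Reduction of the commutator ODE to two independent scalar Riccati equations.**
On an open interval `S`, with `V(t) = Q(t)·diag(λ₁,λ₂)·Q(t)⁻¹`,
`r(t) = H(t)·diag(ζ₁(t),ζ₂(t))·H(t)⁻¹`, `Q(t) = [[1,1],[q₁ t, q₂ t]]`,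
`H(t) = [[1,1],[h₁ t, h₂ t]]`, the matrix equation
`V'(t) = (β'(t)/(z − β(t)))·(r(t)V(t) − V(t)r(t))` holds on `S` iff each `q_k` satisfies
the Riccati equation
`q_k' = −β'·(ζ₁ − ζ₂)·(q_k − h₁)·(q_k − h₂)/((z − β)·(h₁ − h₂))` on `S`. -/
theorem commutator_ode_iff_riccati
    (S : Set ℝ) (hSopen : IsOpen S) (hSinterval : S.OrdConnected)
    (β β' : ℝ → ℂ)
    (hβ : ∀ t ∈ S, HasDerivAt β (β' t) t)
    (hβ' : ContinuousOn β' S)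
    (z : ℂ) (hz : ∀ t ∈ S, z ≠ β t)
    (lam₁ lam₂ : ℂ) (hlam : lam₁ ≠ lam₂)
    (ζ₁ ζ₂ h₁ h₂ : ℝ → ℂ)
    (hζ₁ : ContinuousOn ζ₁ S) (hζ₂ : ContinuousOn ζ₂ S)
    (hh₁ : ContinuousOn h₁ S) (hh₂ : ContinuousOn h₂ S)
    (hh : ∀ t ∈ S, h₁ t ≠ h₂ t)
    (q₁ q₂ q₁' q₂' : ℝ → ℂ)
    (hq : ∀ t ∈ S, q₁ t ≠ q₂ t)
    (hdq₁ : ∀ t ∈ S, HasDerivAt q₁ (q₁' t) t)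
    (hdq₂ : ∀ t ∈ S, HasDerivAt q₂ (q₂' t) t)
    (Q H V r : ℝ → M2)
    (hQ : ∀ t, Q t = !![1, 1; q₁ t, q₂ t])
    (hH : ∀ t, H t = !![1, 1; h₁ t, h₂ t])
    (hV : ∀ t, V t = Q t * Matrix.diagonal ![lam₁, lam₂] * (Q t)⁻¹)
    (hr : ∀ t, r t = H t * Matrix.diagonal ![ζ₁ t, ζ₂ t] * (H t)⁻¹) :
    (∀ t ∈ S, HasDerivAt V ((β' t / (z - β t)) • (r t * V t - V t * r t)) t) ↔
      (∀ t ∈ S,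
        q₁' t = -(β' t) * (ζ₁ t - ζ₂ t) * (q₁ t - h₁ t) * (q₁ t - h₂ t) /
          ((z - β t) * (h₁ t - h₂ t)) ∧
        q₂' t = -(β' t) * (ζ₁ t - ζ₂ t) * (q₂ t - h₁ t) * (q₂ t - h₂ t) /
          ((z - β t) * (h₁ t - h₂ t))) := by
  have hVq : V = fun s => (!![1, 1; q₁ s, q₂ s] : M2) * Matrix.diagonal ![lam₁, lam₂] *
      (!![1, 1; q₁ s, q₂ s] : M2)⁻¹ := funext fun s => by rw [hV, hQ]
  refine forall₂_congr fun t ht => ?_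
  have hderiv : HasDerivAt V (conjVelocity lam₁ lam₂ (q₁ t) (q₂ t) (q₁' t) (q₂' t)) t :=
    hVq ▸ hasDerivAt_conj_diagonal lam₁ lam₂ (hq t ht) (hdq₁ t ht) (hdq₂ t ht)
  rw [smul_commutator_eq_conjVelocity lam₁ lam₂ (ζ₁ t) (ζ₂ t) (β' t) (z - β t)
    (sub_ne_zero.2 (hz t ht)) (hq t ht) (hh t ht) (congrFun hVq t) (by rw [hr, hH]),
    ← conjVelocity_inj hlam (hq t ht)]
  exact ⟨hderiv.unique, fun h => h ▸ hderiv⟩
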